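/- Let m ≥ 1. There exist constants c_m, C_m > 0, depending only on m, such that for every measurable f : ℝ^{2m} → ℂ, every 𝐫 ∈ (0,∞)³ and every x ∈ ℝ^{2m}: c_m · (|f| * χ_{𝐫/2})(x) ≤ |T(x,𝐫)|^{−1} ∫_{T(x,𝐫)} |f(y)| dy ≤ C_m · (|f| * χ_{2𝐫})(x), where 𝐫/2 = (r₁/2,r₂/2,r₃/2) and 2𝐫 = (2r₁,2r₂,2r₃). Consequently there are constants c, C > 0 depending only on m with c · M_iterated f(x) ≤ M_tube f(x) ≤ C · M_iterated f(x) for every x, where M_tube f(x) = sup_{𝐫} |T(x,𝐫)|^{−1}∫_{T(x,𝐫)}|f| and M_iterated f(x) = sup_{𝐫 ∈ (0,∞)³} (|f| * χ_𝐫)(x). -/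

import Mathlib

open MeasureTheory Set Metric ENNReal

noncomputable section

abbrev Em (m : ℕ) := EuclideanSpace ℝ (Fin m)

/-- The tube `T(0,𝐫) ⊆ ℝ^{2m}`. -/
def tube (m : ℕ) (r : ℝ × ℝ × ℝ) : Set (Em m × Em m) :=
  if r.2.2 ≤ min r.1 r.2.1 then
    {x | ‖x.1‖ < r.1 ∧ ‖x.2‖ < r.2.1}
  else if r.2.1 ≤ min r.1 r.2.2 then
    {x | ‖x.1 - x.2‖ < r.1 ∧ ‖x.2‖ < r.2.2}
  else
    {x | ‖x.2 - x.1‖ < r.2.1 ∧ ‖x.1‖ < r.2.2}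

/-- The translated tube `T(x,𝐫) = x + T(0,𝐫)`. -/
def tubeAt (m : ℕ) (x : Em m × Em m) (r : ℝ × ℝ × ℝ) : Set (Em m × Em m) :=
  {y | y - x ∈ tube m r}

/-- The normalized ball characteristic function `χ_r = |B(0,r)|⁻¹ 1_{B(0,r)}` on `ℝ^m`,
with values in `ℝ≥0∞`. -/
def chiBall (m : ℕ) (r : ℝ) : Em m → ℝ≥0∞ :=
  (ball (0 : Em m) r).indicator fun _ => (volume (ball (0 : Em m) r))⁻¹

/-- The normalized ball characteristic function `χ_𝐫 = π_*(χ_{r₁}⊗χ_{r₂}⊗χ_{r₃})`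
on `ℝ^{2m}`, i.e. `χ_𝐫(x₁,x₂) = ∫ χ_{r₁}(x₁−u) χ_{r₂}(x₂−u) χ_{r₃}(u) du`. -/
def chiR (m : ℕ) (r : ℝ × ℝ × ℝ) : Em m × Em m → ℝ≥0∞ :=
  fun x => ∫⁻ u : Em m, chiBall m r.1 (x.1 - u) * chiBall m r.2.1 (x.2 - u) *
    chiBall m r.2.2 u

/-- The convolution `(|f| * g)(x) = ∫ |f(x−y)| g(y) dy`, valued in `ℝ≥0∞`. -/
def convAbs (m : ℕ) (f : Em m × Em m → ℂ) (g : Em m × Em m → ℝ≥0∞) :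
    Em m × Em m → ℝ≥0∞ :=
  fun x => ∫⁻ y : Em m × Em m, (‖f (x - y)‖₊ : ℝ≥0∞) * g y

/-- The tube maximal function. -/
def Mtube (m : ℕ) (f : Em m × Em m → ℂ) (x : Em m × Em m) : ℝ≥0∞ :=
  ⨆ (r : ℝ × ℝ × ℝ) (_ : 0 < r.1 ∧ 0 < r.2.1 ∧ 0 < r.2.2),
    (∫⁻ y in tubeAt m x r, (‖f y‖₊ : ℝ≥0∞)) / volume (tubeAt m x r)

/-- The iterated maximal function `M_iterated f(x) = sup_𝐫 (|f| * χ_𝐫)(x)`. -/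
def Miter (m : ℕ) (f : Em m × Em m → ℂ) (x : Em m × Em m) : ℝ≥0∞ :=
  ⨆ (r : ℝ × ℝ × ℝ) (_ : 0 < r.1 ∧ 0 < r.2.1 ∧ 0 < r.2.2),
    convAbs m f (chiR m r) x

/-- The reciprocal of the volume of a ball of radius `t`. -/
def ballDensity (m : ℕ) (t : ℝ) : ℝ≥0∞ := (volume (ball (0 : Em m) t))⁻¹

lemma volume_ball_ne_zero (m : ℕ) {t : ℝ} (ht : 0 < t) : volume (ball (0 : Em m) t) ≠ 0 :=
  (measure_ball_pos volume 0 ht).ne'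

lemma volume_ball_ne_top (m : ℕ) (t : ℝ) : volume (ball (0 : Em m) t) ≠ ∞ :=
  measure_ball_lt_top.ne

lemma ballDensity_mul_volume (m : ℕ) {t : ℝ} (ht : 0 < t) :
    ballDensity m t * volume (ball (0 : Em m) t) = 1 :=
  ENNReal.inv_mul_cancel (volume_ball_ne_zero m ht) (volume_ball_ne_top m t)

lemma ballDensity_eq_two_pow_mul (m : ℕ) (t : ℝ) :
    ballDensity m t = 2 ^ m * ballDensity m (2 * t) := by
  have h : volume (ball (0 : Em m) (2 * t)) = 2 ^ m * volume (ball (0 : Em m) t) := by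
    rw [Measure.addHaar_ball_mul_of_pos volume 0 two_pos]
    simp [ENNReal.ofReal_pow]
  rw [ballDensity, ballDensity, h, ENNReal.mul_inv (by simp) (by simp), ← mul_assoc,
    ENNReal.mul_inv_cancel (by simp) (by simp), one_mul]

lemma ballDensity_half (m : ℕ) (t : ℝ) : ballDensity m (t / 2) = 2 ^ m * ballDensity m t := by
  rw [ballDensity_eq_two_pow_mul, mul_div_cancel₀ t two_ne_zero]

lemma chiBall_le (m : ℕ) (t : ℝ) (z : Em m) : chiBall m t z ≤ ballDensity m t :=
  indicator_le_self' (fun _ _ => zero_le) z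

lemma chiBall_of_norm_lt (m : ℕ) {t : ℝ} {z : Em m} (h : ‖z‖ < t) :
    chiBall m t z = ballDensity m t :=
  indicator_of_mem (mem_ball_zero_iff.2 h) _

lemma norm_lt_of_chiBall_ne_zero {m : ℕ} {t : ℝ} {z : Em m} (h : chiBall m t z ≠ 0) : ‖z‖ < t :=
  mem_ball_zero_iff.1 (mem_of_indicator_ne_zero h)

lemma lintegral_chiBall (m : ℕ) {t : ℝ} (ht : 0 < t) : ∫⁻ u, chiBall m t u = 1 := by
  simp only [chiBall]
  rw [lintegral_indicator_const measurableSet_ball]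
  exact ballDensity_mul_volume m ht

lemma ballDensity_ne_top (m : ℕ) {t : ℝ} (ht : 0 < t) : ballDensity m t ≠ ∞ :=
  ENNReal.inv_ne_top.2 (volume_ball_ne_zero m ht)

lemma lintegral_const_mul_chiBall {m : ℕ} {a b t : ℝ} (ha : 0 < a) (hb : 0 < b) (ht : 0 < t) :
    ∫⁻ u, ballDensity m a * ballDensity m b * chiBall m t u = ballDensity m a * ballDensity m b := by
  rw [lintegral_const_mul' _ _ (ENNReal.mul_ne_top (ballDensity_ne_top m ha)
    (ballDensity_ne_top m hb)), lintegral_chiBall m ht, mul_one]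

lemma chiR_le_of_fst_snd (m : ℕ) {r : ℝ × ℝ × ℝ} (h₁ : 0 < r.1) (h₂ : 0 < r.2.1) (h₃ : 0 < r.2.2)
    (y : Em m × Em m) : chiR m r y ≤ ballDensity m r.1 * ballDensity m r.2.1 := by
  rw [← lintegral_const_mul_chiBall h₁ h₂ h₃]
  refine lintegral_mono fun u => ?_
  dsimp only
  gcongr <;> exact chiBall_le _ _ _

lemma chiR_le_of_fst_trd (m : ℕ) {r : ℝ × ℝ × ℝ} (h₁ : 0 < r.1) (h₂ : 0 < r.2.1) (h₃ : 0 < r.2.2)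
    (y : Em m × Em m) : chiR m r y ≤ ballDensity m r.1 * ballDensity m r.2.2 := by
  rw [← lintegral_const_mul_chiBall h₁ h₃ h₂, ← lintegral_sub_left_eq_self _ y.2]
  refine lintegral_mono fun u => ?_
  dsimp only
  rw [mul_right_comm]
  gcongr <;> exact chiBall_le _ _ _

lemma chiR_le_of_snd_trd (m : ℕ) {r : ℝ × ℝ × ℝ} (h₁ : 0 < r.1) (h₂ : 0 < r.2.1) (h₃ : 0 < r.2.2)
    (y : Em m × Em m) : chiR m r y ≤ ballDensity m r.2.1 * ballDensity m r.2.2 := by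
  rw [← lintegral_const_mul_chiBall h₂ h₃ h₁, ← lintegral_sub_left_eq_self _ y.1]
  refine lintegral_mono fun u => ?_
  dsimp only
  rw [mul_assoc, mul_comm (chiBall m r.1 _)]
  gcongr <;> exact chiBall_le _ _ _

lemma exists_of_chiR_ne_zero {m : ℕ} {r : ℝ × ℝ × ℝ} {y : Em m × Em m} (h : chiR m r y ≠ 0) :
    ∃ u, ‖y.1 - u‖ < r.1 ∧ ‖y.2 - u‖ < r.2.1 ∧ ‖u‖ < r.2.2 := by
  by_contra! H
  refine h ((lintegral_congr fun u => ?_).trans lintegral_zero)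
  by_contra hu
  simp only [mul_eq_zero, not_or] at hu
  exact (H u (norm_lt_of_chiBall_ne_zero hu.1.1) (norm_lt_of_chiBall_ne_zero hu.1.2)).not_gt
    (norm_lt_of_chiBall_ne_zero hu.2)

lemma le_chiR (m : ℕ) {r : ℝ × ℝ × ℝ} {y : Em m × Em m} (p : Em m) (s : ℝ)
    (h : ∀ u, ‖u - p‖ < s → ‖y.1 - u‖ < r.1 ∧ ‖y.2 - u‖ < r.2.1 ∧ ‖u‖ < r.2.2) :
    ballDensity m r.1 * ballDensity m r.2.1 * ballDensity m r.2.2 * volume (ball (0 : Em m) s) ≤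
      chiR m r y := by
  rw [← Measure.addHaar_ball_center volume p s, ← lintegral_indicator_const measurableSet_ball]
  refine lintegral_mono (indicator_le fun u hu => ?_)
  obtain ⟨h₁, h₂, h₃⟩ := h u (mem_ball_iff_norm.1 hu)
  rw [chiBall_of_norm_lt m h₁, chiBall_of_norm_lt m h₂, chiBall_of_norm_lt m h₃]

lemma volume_prod_balls (m : ℕ) (a b : ℝ) :
    volume {x : Em m × Em m | ‖x.1‖ < a ∧ ‖x.2‖ < b} =
      volume (ball (0 : Em m) a) * volume (ball (0 : Em m) b) := by
  rw [← Measure.prod_prod, ← Measure.volume_eq_prod]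
  congr 1
  ext x
  simp

lemma measurableSet_prod_balls (m : ℕ) (a b : ℝ) :
    MeasurableSet {x : Em m × Em m | ‖x.1‖ < a ∧ ‖x.2‖ < b} := by
  measurability

lemma volume_shear_fst (m : ℕ) (a b : ℝ) :
    volume {x : Em m × Em m | ‖x.1 - x.2‖ < a ∧ ‖x.2‖ < b} =
      volume (ball (0 : Em m) a) * volume (ball (0 : Em m) b) := by
  rw [← volume_prod_balls]
  exact (measurePreserving_sub_prod (volume : Measure (Em m)) volume).measure_preimage
    (measurableSet_prod_balls m a b).nullMeasurableSet

lemma volume_shear_snd (m : ℕ) (a b : ℝ) :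
    volume {x : Em m × Em m | ‖x.2 - x.1‖ < a ∧ ‖x.1‖ < b} =
      volume (ball (0 : Em m) a) * volume (ball (0 : Em m) b) := by
  rw [mul_comm, ← volume_prod_balls]
  simp only [and_comm (a := ‖_ - _‖ < a)]
  exact (measurePreserving_prod_sub (volume : Measure (Em m)) volume).measure_preimage
    (measurableSet_prod_balls m b a).nullMeasurableSet

lemma measurableSet_tube (m : ℕ) (r : ℝ × ℝ × ℝ) : MeasurableSet (tube m r) := by
  unfold tube
  split_ifs
  · exact measurableSet_prod_balls m _ _
  · exact (measurePreserving_sub_prod (volume : Measure (Em m)) volume).measurable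
      (measurableSet_prod_balls m _ _)
  · simp only [and_comm (a := ‖_ - _‖ < _)]
    exact (measurePreserving_prod_sub (volume : Measure (Em m)) volume).measurable
      (measurableSet_prod_balls m _ _)

lemma neg_mem_tube_iff {m : ℕ} {r : ℝ × ℝ × ℝ} {y : Em m × Em m} :
    -y ∈ tube m r ↔ y ∈ tube m r := by
  have h : ∀ a b : Em m, ‖-a + b‖ = ‖a - b‖ := fun a b => by rw [← norm_neg]; congr 1; abel
  unfold tube
  split_ifs <;> simp [h]

lemma inv_ballVolume_mul (m : ℕ) (a b : ℝ) :
    (volume (ball (0 : Em m) a) * volume (ball (0 : Em m) b))⁻¹ =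
      ballDensity m a * ballDensity m b :=
  ENNReal.mul_inv (.inr (volume_ball_ne_top m b)) (.inl (volume_ball_ne_top m a))

lemma ballDensity_mul_eq (m : ℕ) {a b s : ℝ} (hs : 0 < s) :
    ballDensity m a * ballDensity m b = 2 ^ m * 2 ^ m * 2 ^ m *
      (ballDensity m (2 * a) * ballDensity m (2 * b) * ballDensity m (2 * s) *
        volume (ball (0 : Em m) s)) := by
  rw [← mul_one (ballDensity m a * ballDensity m b), ← ballDensity_mul_volume m hs,
    ballDensity_eq_two_pow_mul m a, ballDensity_eq_two_pow_mul m b, ballDensity_eq_two_pow_mul m s]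
  ring

lemma mem_tube_of_chiR_half_ne_zero {m : ℕ} {r : ℝ × ℝ × ℝ} {y : Em m × Em m}
    (h : chiR m (r.1 / 2, r.2.1 / 2, r.2.2 / 2) y ≠ 0) : y ∈ tube m r := by
  obtain ⟨u, h₁, h₂, h₃⟩ := exists_of_chiR_ne_zero h
  dsimp only at h₁ h₂ h₃
  have e₁ := norm_le_norm_sub_add y.1 u
  have e₂ := norm_le_norm_sub_add y.2 u
  have e₃ := norm_sub_le_norm_sub_add_norm_sub y.1 u y.2
  rw [norm_sub_rev u] at e₃
  have e₄ := norm_sub_rev y.2 y.1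
  unfold tube
  split_ifs with c₁ c₂
  · rw [le_min_iff] at c₁
    constructor <;> linarith
  · rw [le_min_iff] at c₂
    constructor <;> linarith
  · have c₃ : r.1 ≤ r.2.1 ∧ r.1 ≤ r.2.2 := by grind
    constructor <;> linarith

lemma chiR_half_le (m : ℕ) {r : ℝ × ℝ × ℝ} (h₁ : 0 < r.1) (h₂ : 0 < r.2.1) (h₃ : 0 < r.2.2)
    (y : Em m × Em m) :
    chiR m (r.1 / 2, r.2.1 / 2, r.2.2 / 2) y ≤ 2 ^ m * 2 ^ m * (volume (tube m r))⁻¹ := by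
  have key : ∀ a b : ℝ, ballDensity m (a / 2) * ballDensity m (b / 2) = 2 ^ m * 2 ^ m *
      (volume (ball (0 : Em m) a) * volume (ball (0 : Em m) b))⁻¹ := fun a b => by
    rw [inv_ballVolume_mul, ballDensity_half, ballDensity_half]
    ring
  unfold tube
  split_ifs
  · rw [volume_prod_balls, ← key]
    exact chiR_le_of_fst_snd m (half_pos h₁) (half_pos h₂) (half_pos h₃) y
  · rw [volume_shear_fst, ← key]
    exact chiR_le_of_fst_trd m (half_pos h₁) (half_pos h₂) (half_pos h₃) y
  · rw [volume_shear_snd, ← key]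
    exact chiR_le_of_snd_trd m (half_pos h₁) (half_pos h₂) (half_pos h₃) y

lemma inv_volume_tube_le (m : ℕ) {r : ℝ × ℝ × ℝ} (h₁ : 0 < r.1) (h₂ : 0 < r.2.1) (h₃ : 0 < r.2.2)
    {y : Em m × Em m} (hy : y ∈ tube m r) :
    (volume (tube m r))⁻¹ ≤
      2 ^ m * 2 ^ m * 2 ^ m * chiR m (2 * r.1, 2 * r.2.1, 2 * r.2.2) y := by
  unfold tube at hy ⊢
  split_ifs at hy ⊢ with c₁ c₂
  · rw [volume_prod_balls, inv_ballVolume_mul, ballDensity_mul_eq m h₃]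
    gcongr
    refine le_chiR m (r := (2 * r.1, 2 * r.2.1, 2 * r.2.2)) 0 r.2.2 fun u hu => ?_
    rw [sub_zero] at hu
    have e₁ := norm_sub_le y.1 u
    have e₂ := norm_sub_le y.2 u
    rw [le_min_iff] at c₁
    obtain ⟨hy₁, hy₂⟩ := hy
    refine ⟨?_, ?_, ?_⟩ <;> dsimp only <;> linarith
  · rw [volume_shear_fst, inv_ballVolume_mul, ballDensity_mul_eq m h₂,
      mul_right_comm (ballDensity m _)]
    gcongr
    refine le_chiR m (r := (2 * r.1, 2 * r.2.1, 2 * r.2.2)) y.2 r.2.1 fun u hu => ?_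
    have e₁ := norm_sub_le_norm_sub_add_norm_sub y.1 y.2 u
    have e₂ := norm_sub_rev u y.2
    have e₃ := norm_le_norm_sub_add u y.2
    rw [le_min_iff] at c₂
    obtain ⟨hy₁, hy₂⟩ := hy
    refine ⟨?_, ?_, ?_⟩ <;> dsimp only <;> linarith
  · have c₃ : r.1 ≤ r.2.1 ∧ r.1 ≤ r.2.2 := by grind
    rw [volume_shear_snd, inv_ballVolume_mul, ballDensity_mul_eq m h₁,
      mul_comm (_ * _) (ballDensity m (2 * r.1)), ← mul_assoc (ballDensity m (2 * r.1))]
    gcongr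
    refine le_chiR m (r := (2 * r.1, 2 * r.2.1, 2 * r.2.2)) y.1 r.1 fun u hu => ?_
    have e₁ := norm_sub_le_norm_sub_add_norm_sub y.2 y.1 u
    have e₂ := norm_sub_rev u y.1
    have e₃ := norm_le_norm_sub_add u y.1
    obtain ⟨hy₁, hy₂⟩ := hy
    refine ⟨?_, ?_, ?_⟩ <;> dsimp only <;> linarith

lemma volume_tube_ne_zero (m : ℕ) {r : ℝ × ℝ × ℝ} (h₁ : 0 < r.1) (h₂ : 0 < r.2.1)
    (h₃ : 0 < r.2.2) : volume (tube m r) ≠ 0 := by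
  unfold tube
  split_ifs
  · rw [volume_prod_balls]
    exact mul_ne_zero (volume_ball_ne_zero m h₁) (volume_ball_ne_zero m h₂)
  · rw [volume_shear_fst]
    exact mul_ne_zero (volume_ball_ne_zero m h₁) (volume_ball_ne_zero m h₃)
  · rw [volume_shear_snd]
    exact mul_ne_zero (volume_ball_ne_zero m h₂) (volume_ball_ne_zero m h₃)

instance (m : ℕ) : (volume : Measure (Em m × Em m)).IsAddHaarMeasure :=
  Measure.prod.instIsAddHaarMeasure volume volume

instance (m : ℕ) : (volume : Measure (Em m × Em m)).IsNegInvariant :=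
  ⟨((Measure.measurePreserving_neg (volume : Measure (Em m))).prod
    (Measure.measurePreserving_neg (volume : Measure (Em m)))).map_eq⟩

lemma volume_tubeAt (m : ℕ) (x : Em m × Em m) (r : ℝ × ℝ × ℝ) :
    volume (tubeAt m x r) = volume (tube m r) :=
  (measurePreserving_sub_right volume x).measure_preimage (measurableSet_tube m r).nullMeasurableSet

lemma setLIntegral_tubeAt (m : ℕ) (x : Em m × Em m) (r : ℝ × ℝ × ℝ) (g : Em m × Em m → ℝ≥0∞) :
    ∫⁻ y in tubeAt m x r, g y = ∫⁻ y in tube m r, g (x - y) := by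
  have hx : MeasurableSet (tubeAt m x r) := (measurable_sub_const x) (measurableSet_tube m r)
  rw [← lintegral_indicator hx, ← lintegral_indicator (measurableSet_tube m r),
    ← lintegral_sub_left_eq_self _ x]
  refine lintegral_congr fun y => ?_
  have : x - y ∈ tubeAt m x r ↔ y ∈ tube m r := by
    rw [← neg_mem_tube_iff]
    simp [tubeAt]
  by_cases hy : y ∈ tube m r
  · rw [indicator_of_mem hy, indicator_of_mem (this.2 hy)]
  · rw [indicator_of_notMem hy, indicator_of_notMem (mt this.1 hy)]

lemma convAbs_chiR_half_le_average (m : ℕ) (f : Em m × Em m → ℂ) {r : ℝ × ℝ × ℝ} (h₁ : 0 < r.1)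
    (h₂ : 0 < r.2.1) (h₃ : 0 < r.2.2) (x : Em m × Em m) :
    ENNReal.ofReal (4 ^ m)⁻¹ * convAbs m f (chiR m (r.1 / 2, r.2.1 / 2, r.2.2 / 2)) x ≤
      (∫⁻ y in tubeAt m x r, (‖f y‖₊ : ℝ≥0∞)) / volume (tubeAt m x r) := by
  have hc : ENNReal.ofReal (4 ^ m)⁻¹ = (2 ^ m * 2 ^ m)⁻¹ := by
    rw [ENNReal.ofReal_inv_of_pos (by positivity), ENNReal.ofReal_pow (by norm_num), ← mul_pow]
    norm_num
  rw [hc, volume_tubeAt, setLIntegral_tubeAt, ENNReal.div_eq_inv_mul]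
  calc (2 ^ m * 2 ^ m)⁻¹ * convAbs m f (chiR m (r.1 / 2, r.2.1 / 2, r.2.2 / 2)) x
      ≤ (2 ^ m * 2 ^ m)⁻¹ * ∫⁻ y in tube m r,
          2 ^ m * 2 ^ m * (volume (tube m r))⁻¹ * (‖f (x - y)‖₊ : ℝ≥0∞) := by
        gcongr
        rw [← lintegral_indicator (measurableSet_tube m r)]
        refine lintegral_mono fun y => ?_
        by_cases hy : y ∈ tube m r
        · rw [indicator_of_mem hy, mul_comm]
          gcongr
          exact chiR_half_le m h₁ h₂ h₃ y
        · have : chiR m (r.1 / 2, r.2.1 / 2, r.2.2 / 2) y = 0 :=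
            not_not.1 (mt mem_tube_of_chiR_half_ne_zero hy)
          simp [this]
    _ = (volume (tube m r))⁻¹ * ∫⁻ y in tube m r, (‖f (x - y)‖₊ : ℝ≥0∞) := by
        rw [lintegral_const_mul' _ _ (ENNReal.mul_ne_top (by finiteness)
          (ENNReal.inv_ne_top.2 (volume_tube_ne_zero m h₁ h₂ h₃))), ← mul_assoc, ← mul_assoc,
          ENNReal.inv_mul_cancel (by simp) (by finiteness), one_mul]

lemma average_le_convAbs_chiR_two_mul (m : ℕ) (f : Em m × Em m → ℂ) {r : ℝ × ℝ × ℝ} (h₁ : 0 < r.1)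
    (h₂ : 0 < r.2.1) (h₃ : 0 < r.2.2) (x : Em m × Em m) :
    (∫⁻ y in tubeAt m x r, (‖f y‖₊ : ℝ≥0∞)) / volume (tubeAt m x r) ≤
      ENNReal.ofReal (8 ^ m) * convAbs m f (chiR m (2 * r.1, 2 * r.2.1, 2 * r.2.2)) x := by
  have hC : ENNReal.ofReal (8 ^ m) = 2 ^ m * 2 ^ m * 2 ^ m := by
    rw [ENNReal.ofReal_pow (by norm_num), ← mul_pow, ← mul_pow]
    norm_num
  rw [hC, volume_tubeAt, setLIntegral_tubeAt, ENNReal.div_eq_inv_mul, convAbs,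
    ← lintegral_const_mul' _ _ (ENNReal.inv_ne_top.2 (volume_tube_ne_zero m h₁ h₂ h₃)),
    ← lintegral_const_mul' _ _ (by finiteness), ← lintegral_indicator (measurableSet_tube m r)]
  refine lintegral_mono (indicator_le fun y hy => ?_)
  rw [mul_comm, mul_left_comm]
  gcongr
  exact inv_volume_tube_le m h₁ h₂ h₃ hy

/-- There exist `c_m, C_m > 0` depending only on `m` such that for every
measurable `f`, radii `𝐫 ∈ (0,∞)³` and point `x`,
`c_m (|f| * χ_{𝐫/2})(x) ≤ |T(x,𝐫)|⁻¹ ∫_{T(x,𝐫)} |f| ≤ C_m (|f| * χ_{2𝐫})(x)`;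
consequently `M_tube f ≃ M_iterated f` pointwise with constants depending only on `m`. -/
theorem average_tube_comparable_chi (m : ℕ) (hm : 1 ≤ m) :
    (∃ c C : ℝ, 0 < c ∧ 0 < C ∧
      ∀ f : Em m × Em m → ℂ, Measurable f →
        ∀ r : ℝ × ℝ × ℝ, 0 < r.1 → 0 < r.2.1 → 0 < r.2.2 →
        ∀ x : Em m × Em m,
          ENNReal.ofReal c * convAbs m f (chiR m (r.1 / 2, r.2.1 / 2, r.2.2 / 2)) x ≤
            (∫⁻ y in tubeAt m x r, (‖f y‖₊ : ℝ≥0∞)) / volume (tubeAt m x r) ∧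
          (∫⁻ y in tubeAt m x r, (‖f y‖₊ : ℝ≥0∞)) / volume (tubeAt m x r) ≤
            ENNReal.ofReal C * convAbs m f (chiR m (2 * r.1, 2 * r.2.1, 2 * r.2.2)) x) ∧
    (∃ c C : ℝ, 0 < c ∧ 0 < C ∧
      ∀ f : Em m × Em m → ℂ, Measurable f → ∀ x : Em m × Em m,
        ENNReal.ofReal c * Miter m f x ≤ Mtube m f x ∧
        Mtube m f x ≤ ENNReal.ofReal C * Miter m f x) := by
  have hc : (0 : ℝ) < (4 ^ m)⁻¹ := by positivity
  have hC : (0 : ℝ) < 8 ^ m := by positivity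
  refine ⟨⟨_, _, hc, hC, fun f _ r h₁ h₂ h₃ x =>
    ⟨convAbs_chiR_half_le_average m f h₁ h₂ h₃ x, average_le_convAbs_chiR_two_mul m f h₁ h₂ h₃ x⟩⟩,
    ⟨_, _, hc, hC, fun f _ x => ⟨?_, ?_⟩⟩⟩
  · simp only [Miter, ENNReal.mul_iSup]
    refine iSup₂_le fun r ⟨h₁, h₂, h₃⟩ => ?_
    have p₁ := mul_pos two_pos h₁
    have p₂ := mul_pos two_pos h₂
    have p₃ := mul_pos two_pos h₃
    have h := convAbs_chiR_half_le_average m f (r := (2 * r.1, 2 * r.2.1, 2 * r.2.2)) p₁ p₂ p₃ x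
    simp only [mul_div_cancel_left₀ _ (two_ne_zero' ℝ), Prod.mk.eta] at h
    exact h.trans (le_iSup₂_of_le _ ⟨p₁, p₂, p₃⟩ le_rfl)
  · refine iSup₂_le fun r ⟨h₁, h₂, h₃⟩ => ?_
    refine (average_le_convAbs_chiR_two_mul m f h₁ h₂ h₃ x).trans ?_
    gcongr
    exact le_iSup₂_of_le (2 * r.1, 2 * r.2.1, 2 * r.2.2)
      ⟨mul_pos two_pos h₁, mul_pos two_pos h₂, mul_pos two_pos h₃⟩ le_rfl
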